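/- arXiv:2110.02608 — 3 statements merged into one kernel-verified Lean document; each statement's English description precedes it below -/
import Mathlib

section
/- Suppose the equation x' = −x² + q(t)x + p(t) has bounded solutions and the globally defined solutions a and r are uniformly separated, so that a and r are attractive and repulsive hyperbolic solutions with dichotomy constant pairs (k_a, β_a) and (k_r, β_r), respectively. Then for any β̄_a ∈ (0, β_a), β̄_r ∈ (0, β_r) and any ε > 0, there exist k_{a,ε} ≥ 1 and k_{r,ε} ≥ 1 such that: |a(t) − x(t,s,x₀)| ≤ k_{a,ε} e^{−β̄_a(t−s)} |a(s) − x₀| whenever x₀ ≥ r(s) + ε and t ≥ s; |r(t) − x(t,s,x₀)| ≤ k_{r,ε} e^{β̄_r(t−s)} |r(s) − x₀| whenever x₀ ≤ a(s) − ε and t ≤ s. In addition, |a(t) − x(t,s,x₀)| ≤ k_a e^{−β_a(t−s)} |a(s) − x₀| whenever x₀ ≥ a(s) and t ≥ s, and |r(t) − x(t,s,x₀)| ≤ k_r e^{β_r(t−s)} |r(s) − x₀| whenever x₀ ≤ r(s) and t ≤ s. -/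
open Set Filter

/-- The right-hand side of the quadratic equation `x' = -x² + Q(t)x + P(t)`. -/
def quadF (Q P : ℝ → ℝ) : ℝ → ℝ → ℝ := fun t x => -x ^ 2 + Q t * x + P t

/-- `b` is a globally defined bounded solution of `x' = -x² + Q(t)x + P(t)`. -/
def IsBddSol (Q P b : ℝ → ℝ) : Prop :=
  (∀ t, HasDerivAt b (quadF Q P t (b t)) t) ∧ ∃ C, ∀ t, |b t| ≤ C

/-- `(k, β)` is a dichotomy constant pair witnessing that the variational equation
`z' = (-2 b(t) + Q(t)) z` is Hurwitz at `+∞` (attractive case). -/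
def AttrDich (Q b : ℝ → ℝ) (k β : ℝ) : Prop :=
  1 ≤ k ∧ 0 < β ∧ ∀ s t : ℝ, s ≤ t →
    Real.exp (∫ l in s..t, (-2 * b l + Q l)) ≤ k * Real.exp (-β * (t - s))

/-- `(k, β)` is a dichotomy constant pair witnessing that the variational equation
`z' = (-2 b(t) + Q(t)) z` is Hurwitz at `−∞` (repulsive case). -/
def RepDich (Q b : ℝ → ℝ) (k β : ℝ) : Prop :=
  1 ≤ k ∧ 0 < β ∧ ∀ s t : ℝ, t ≤ s →
    Real.exp (∫ l in s..t, (-2 * b l + Q l)) ≤ k * Real.exp (β * (t - s))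

/-- `b` is an attractive hyperbolic solution of `x' = -x² + Q(t)x + P(t)`. -/
def IsAttrHyp (Q P b : ℝ → ℝ) : Prop := IsBddSol Q P b ∧ ∃ k β : ℝ, AttrDich Q b k β

/-- `b` is a repulsive hyperbolic solution of `x' = -x² + Q(t)x + P(t)`. -/
def IsRepHyp (Q P b : ℝ → ℝ) : Prop := IsBddSol Q P b ∧ ∃ k β : ℝ, RepDich Q b k β

/-- `b` is a hyperbolic solution of `x' = -x² + Q(t)x + P(t)`. -/
def IsHyp (Q P b : ℝ → ℝ) : Prop := IsAttrHyp Q P b ∨ IsRepHyp Q P b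

/-- The supremum norm distance between `f` and `g` is `< δ`. -/
def SupLt (f g : ℝ → ℝ) (δ : ℝ) : Prop := ∃ d : ℝ, d < δ ∧ ∀ t, |f t - g t| ≤ d

/-- The family of maximal solutions `t ↦ X t s x₀` of the scalar ODE `x' = h (t, x)`. -/
structure MaxSolFamily (h : ℝ → ℝ → ℝ) where
  X : ℝ → ℝ → ℝ → ℝ
  dom : ℝ → ℝ → Set ℝ
  dom_open : ∀ s x₀, IsOpen (dom s x₀)
  dom_ordConn : ∀ s x₀, (dom s x₀).OrdConnected
  mem_dom : ∀ s x₀, s ∈ dom s x₀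
  init : ∀ s x₀, X s s x₀ = x₀
  sol : ∀ s x₀, ∀ t ∈ dom s x₀, HasDerivAt (fun τ => X τ s x₀) (h t (X t s x₀)) t
  maximal : ∀ s x₀ (y : ℝ → ℝ) (I : Set ℝ), IsOpen I → I.OrdConnected → s ∈ I →
      y s = x₀ → (∀ t ∈ I, HasDerivAt y (h t (y t)) t) →
      I ⊆ dom s x₀ ∧ ∀ t ∈ I, y t = X t s x₀

/-- The solution `X · s x₀` is (defined and) bounded as `t → −∞`. -/
def BddAtBot {h : ℝ → ℝ → ℝ} (F : MaxSolFamily h) (s x₀ : ℝ) : Prop :=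
  ∃ C : ℝ, ∀ᶠ t in atBot, t ∈ F.dom s x₀ ∧ |F.X t s x₀| ≤ C

/-- The solution `X · s x₀` is (defined and) bounded as `t → ∞`. -/
def BddAtTop {h : ℝ → ℝ → ℝ} (F : MaxSolFamily h) (s x₀ : ℝ) : Prop :=
  ∃ C : ℝ, ∀ᶠ t in atTop, t ∈ F.dom s x₀ ∧ |F.X t s x₀| ≤ C

/-- `a` is the globally defined bounded solution characterized by:
`X · s x₀` is bounded as `t → −∞` iff `x₀ ≤ a s`. -/
def CharA {h : ℝ → ℝ → ℝ} (F : MaxSolFamily h) (a : ℝ → ℝ) : Prop :=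
  (∀ t, HasDerivAt a (h t (a t)) t) ∧ (∃ C, ∀ t, |a t| ≤ C) ∧
  ∀ s x₀ : ℝ, BddAtBot F s x₀ ↔ x₀ ≤ a s

/-- `r` is the globally defined bounded solution characterized by:
`X · s x₀` is bounded as `t → ∞` iff `x₀ ≥ r s`. -/
def CharR {h : ℝ → ℝ → ℝ} (F : MaxSolFamily h) (r : ℝ → ℝ) : Prop :=
  (∀ t, HasDerivAt r (h t (r t)) t) ∧ (∃ C, ∀ t, |r t| ≤ C) ∧
  ∀ s x₀ : ℝ, BddAtTop F s x₀ ↔ r s ≤ x₀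

/-- The fundamental solution, normalized at time `s`, of the variational equation
`z' = (-2 b(t) + Q(t)) z`. -/
noncomputable def varSol (Q b : ℝ → ℝ) (s t : ℝ) : ℝ :=
  Real.exp (∫ l in s..t, (-2 * b l + Q l))

lemma varSol_pos (Q b : ℝ → ℝ) (s t : ℝ) : 0 < varSol Q b s t := Real.exp_pos _

lemma varSol_self (Q b : ℝ → ℝ) (s : ℝ) : varSol Q b s s = 1 := by simp [varSol]

lemma hasDerivAt_varSol {Q b : ℝ → ℝ} (hQ : Continuous Q) (hb : Continuous b) (s t : ℝ) :
    HasDerivAt (varSol Q b s) (varSol Q b s t * (-2 * b t + Q t)) t := by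
  have hc : Continuous fun l => -2 * b l + Q l := by fun_prop
  exact (intervalIntegral.integral_hasDerivAt_right (hc.intervalIntegrable _ _)
    hc.stronglyMeasurable.stronglyMeasurableAtFilter hc.continuousAt).exp

lemma continuous_varSol {Q b : ℝ → ℝ} (hQ : Continuous Q) (hb : Continuous b) (s : ℝ) :
    Continuous (varSol Q b s) :=
  continuous_iff_continuousAt.2 fun t => (hasDerivAt_varSol hQ hb s t).continuousAt

/-- The denominator in the explicit solution of the Bernoulli equation
`y' = (-2 b(t) + Q(t)) y - y²`, `y(s) = y₀`. -/
noncomputable def bernoulliDenom (Q b : ℝ → ℝ) (s y₀ t : ℝ) : ℝ :=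
  1 + y₀ * ∫ l in s..t, varSol Q b s l

lemma bernoulliDenom_self (Q b : ℝ → ℝ) (s y₀ : ℝ) : bernoulliDenom Q b s y₀ s = 1 := by
  simp [bernoulliDenom]

lemma hasDerivAt_bernoulliDenom {Q b : ℝ → ℝ} (hQ : Continuous Q) (hb : Continuous b)
    (s y₀ t : ℝ) :
    HasDerivAt (bernoulliDenom Q b s y₀) (y₀ * varSol Q b s t) t := by
  have hc := continuous_varSol hQ hb s
  exact ((intervalIntegral.integral_hasDerivAt_right (hc.intervalIntegrable _ _)
    hc.stronglyMeasurable.stronglyMeasurableAtFilter hc.continuousAt).const_mul y₀).const_add 1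

lemma ordConnected_bernoulliDenom_pos {Q b : ℝ → ℝ} (hQ : Continuous Q) (hb : Continuous b)
    (s y₀ : ℝ) : {t | 0 < bernoulliDenom Q b s y₀ t}.OrdConnected := by
  have hd := hasDerivAt_bernoulliDenom hQ hb s y₀
  have hdiff : Differentiable ℝ (bernoulliDenom Q b s y₀) := fun t => (hd t).differentiableAt
  refine ⟨fun u hu v hv w hw => ?_⟩
  rcases le_total 0 y₀ with h | h
  · have hm := monotone_of_deriv_nonneg hdiff fun t => by
      rw [(hd t).deriv]; exact mul_nonneg h (varSol_pos ..).le
    exact lt_of_lt_of_le hu (hm hw.1)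
  · have hm := antitone_of_deriv_nonpos hdiff fun t => by
      rw [(hd t).deriv]; exact mul_nonpos_of_nonpos_of_nonneg h (varSol_pos ..).le
    exact lt_of_lt_of_le hv (hm hw.2)

/-- Solutions of the quadratic equation expressed through a reference solution `b`. -/
lemma MaxSolFamily.eq_add_bernoulli {Q P b : ℝ → ℝ} (F : MaxSolFamily (quadF Q P))
    (hQ : Continuous Q) (hb : ∀ t, HasDerivAt b (quadF Q P t (b t)) t) {s x₀ t : ℝ}
    (ht : 0 < bernoulliDenom Q b s (x₀ - b s) t) :
    t ∈ F.dom s x₀ ∧ F.X t s x₀ =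
      b t + varSol Q b s t * (x₀ - b s) / bernoulliDenom Q b s (x₀ - b s) t := by
  have hbc : Continuous b := continuous_iff_continuousAt.2 fun t => (hb t).continuousAt
  have hd := hasDerivAt_bernoulliDenom hQ hbc s (x₀ - b s)
  have hdc : Continuous (bernoulliDenom Q b s (x₀ - b s)) :=
    continuous_iff_continuousAt.2 fun t => (hd t).continuousAt
  have key := F.maximal s x₀
    (fun τ => b τ + varSol Q b s τ * (x₀ - b s) / bernoulliDenom Q b s (x₀ - b s) τ)
    {τ | 0 < bernoulliDenom Q b s (x₀ - b s) τ} (isOpen_lt continuous_const hdc)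
    (ordConnected_bernoulliDenom_pos hQ hbc s _)
    (by simp [bernoulliDenom_self]) (by simp [bernoulliDenom_self, varSol_self]) ?_
  · exact ⟨key.1 ht, (key.2 t ht).symm⟩
  · intro τ hτ
    have hne : bernoulliDenom Q b s (x₀ - b s) τ ≠ 0 := ne_of_gt hτ
    refine ((hb τ).add
      (((hasDerivAt_varSol hQ hbc s τ).mul_const (x₀ - b s)).div (hd τ) hne)).congr_deriv ?_
    simp only [quadF]
    field_simp
    ring

lemma MaxSolFamily.abs_sub_le {Q P b : ℝ → ℝ} (F : MaxSolFamily (quadF Q P))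
    (hQ : Continuous Q) (hb : ∀ t, HasDerivAt b (quadF Q P t (b t)) t) {s x₀ t m K : ℝ}
    (hm : 0 < m) (hmt : m ≤ bernoulliDenom Q b s (x₀ - b s) t) (hK : varSol Q b s t ≤ K) :
    t ∈ F.dom s x₀ ∧ |b t - F.X t s x₀| ≤ m⁻¹ * K * |b s - x₀| := by
  have hpos := hm.trans_le hmt
  obtain ⟨hdom, hX⟩ := F.eq_add_bernoulli hQ hb hpos
  refine ⟨hdom, ?_⟩
  have hE := varSol_pos Q b s t
  rw [hX, sub_add_cancel_left, abs_neg, abs_div, abs_mul, abs_of_pos hpos, abs_of_pos hE,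
    abs_sub_comm x₀, div_eq_mul_inv, mul_comm _ (_⁻¹), ← mul_assoc]
  gcongr

/-- The integral of the variational solution along `b`, in terms of a second solution `c` that
never meets `b`. -/
lemma integral_varSol {Q P b c : ℝ → ℝ} (hQ : Continuous Q)
    (hb : ∀ t, HasDerivAt b (quadF Q P t (b t)) t)
    (hc : ∀ t, HasDerivAt c (quadF Q P t (c t)) t) (hbc : ∀ t, c t - b t ≠ 0) (s t : ℝ) :
    ∫ l in s..t, varSol Q b s l = varSol Q b s t / (c t - b t) - 1 / (c s - b s) := by
  have hbcont : Continuous b := continuous_iff_continuousAt.2 fun t => (hb t).continuousAt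
  rw [intervalIntegral.integral_eq_sub_of_hasDerivAt
    (f := fun τ => varSol Q b s τ / (c τ - b τ)) (fun τ _ => ?_)
    ((continuous_varSol hQ hbcont s).intervalIntegrable _ _), varSol_self]
  refine ((hasDerivAt_varSol hQ hbcont s τ).div ((hc τ).sub (hb τ)) (hbc τ)).congr_deriv ?_
  have := hbc τ
  simp only [quadF, Pi.sub_apply]
  field_simp
  ring

lemma one_le_bernoulliDenom {Q b : ℝ → ℝ} {s y₀ t : ℝ}
    (h : s ≤ t ∧ 0 ≤ y₀ ∨ t ≤ s ∧ y₀ ≤ 0) : 1 ≤ bernoulliDenom Q b s y₀ t := by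
  have hE : ∀ l, 0 ≤ varSol Q b s l := fun l => (varSol_pos Q b s l).le
  refine le_add_of_nonneg_right ?_
  rcases h with ⟨hst, hy⟩ | ⟨hst, hy⟩
  · exact mul_nonneg hy (intervalIntegral.integral_nonneg hst fun l _ => hE l)
  · refine mul_nonneg_of_nonpos_of_nonpos hy ?_
    rw [intervalIntegral.integral_symm]
    exact neg_nonpos.2 (intervalIntegral.integral_nonneg hst fun l _ => hE l)

/-- If `y₀` lies on the same side of zero as `c s - b s`, then the explicit denominator is bounded
below by the relative distance from `y₀` to `c s - b s`. -/
lemma le_bernoulliDenom {Q P b c : ℝ → ℝ} (hQ : Continuous Q)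
    (hb : ∀ t, HasDerivAt b (quadF Q P t (b t)) t)
    (hc : ∀ t, HasDerivAt c (quadF Q P t (c t)) t) (hbc : ∀ t, c t - b t ≠ 0) {s y₀ t : ℝ}
    (h : 0 ≤ y₀ / (c t - b t)) :
    1 - y₀ / (c s - b s) ≤ bernoulliDenom Q b s y₀ t := by
  have hE := varSol_pos Q b s t
  rw [bernoulliDenom, integral_varSol hQ hb hc hbc]
  have : 0 ≤ varSol Q b s t * (y₀ / (c t - b t)) := mul_nonneg hE.le h
  calc 1 - y₀ / (c s - b s)
      ≤ 1 - y₀ / (c s - b s) + varSol Q b s t * (y₀ / (c t - b t)) := by linarith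
    _ = _ := by ring

theorem stmt9 (q p : ℝ → ℝ)
    (hqb : ∃ C, ∀ t, |q t| ≤ C) (hqu : UniformContinuous q)
    (hpb : ∃ C, ∀ t, |p t| ≤ C) (hpu : UniformContinuous p)
    (F : MaxSolFamily (quadF q p))
    (a r : ℝ → ℝ)
    (ha : CharA F a) (hr : CharR F r)
    (hsep : ∃ δ > (0:ℝ), ∀ t, δ ≤ a t - r t)
    (ka βa kr βr : ℝ)
    (hdicha : AttrDich q a ka βa) (hdichr : RepDich q r kr βr) :
    (∀ βa' : ℝ, 0 < βa' → βa' < βa → ∀ βr' : ℝ, 0 < βr' → βr' < βr →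
      ∀ ε > (0:ℝ), ∃ kaε ≥ (1:ℝ), ∃ krε ≥ (1:ℝ),
        (∀ s x₀ t : ℝ, r s + ε ≤ x₀ → s ≤ t →
          t ∈ F.dom s x₀ ∧
          |a t - F.X t s x₀| ≤ kaε * Real.exp (-βa' * (t - s)) * |a s - x₀|) ∧
        (∀ s x₀ t : ℝ, x₀ ≤ a s - ε → t ≤ s →
          t ∈ F.dom s x₀ ∧
          |r t - F.X t s x₀| ≤ krε * Real.exp (βr' * (t - s)) * |r s - x₀|)) ∧
    (∀ s x₀ t : ℝ, a s ≤ x₀ → s ≤ t →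
      t ∈ F.dom s x₀ ∧
      |a t - F.X t s x₀| ≤ ka * Real.exp (-βa * (t - s)) * |a s - x₀|) ∧
    (∀ s x₀ t : ℝ, x₀ ≤ r s → t ≤ s →
      t ∈ F.dom s x₀ ∧
      |r t - F.X t s x₀| ≤ kr * Real.exp (βr * (t - s)) * |r s - x₀|) := by
  obtain ⟨hda, ⟨Ca, hCa⟩, -⟩ := ha
  obtain ⟨hdr, ⟨Cr, hCr⟩, -⟩ := hr
  obtain ⟨δ, hδ, hsep⟩ := hsep
  have hq := hqu.continuous
  obtain ⟨hka, -, hEa⟩ := hdicha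
  obtain ⟨hkr, -, hEr⟩ := hdichr
  have hpos : ∀ t, 0 < a t - r t := fun t => hδ.trans_le (hsep t)
  have hM : ∀ t, a t - r t ≤ Ca + Cr := fun t => by
    linarith [(abs_le.1 (hCa t)).2, (abs_le.1 (hCr t)).1]
  have hM0 : 0 < Ca + Cr := (hpos 0).trans_le (hM 0)
  refine ⟨fun βa' _ hβa βr' _ hβr ε hε => ?_, fun s x₀ t hx hst => ?_, fun s x₀ t hx hts => ?_⟩
  · set m := min 1 (ε / (Ca + Cr))
    have hm0 : 0 < m := lt_min one_pos (div_pos hε hM0)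
    have hm1 : 1 ≤ m⁻¹ := (one_le_inv₀ hm0).2 (min_le_left _ _)
    have hrel : ∀ {u s : ℝ}, u ≤ a s - r s - ε → m ≤ 1 - u / (a s - r s) := fun {u s} hu => by
      have hd := hpos s
      calc m ≤ ε / (Ca + Cr) := min_le_right _ _
        _ ≤ ε / (a s - r s) := div_le_div_of_nonneg_left hε.le hd (hM s)
        _ = 1 - (a s - r s - ε) / (a s - r s) := by field_simp; ring
        _ ≤ 1 - u / (a s - r s) := by gcongr
    refine ⟨m⁻¹ * ka, one_le_mul_of_one_le_of_one_le hm1 hka,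
      m⁻¹ * kr, one_le_mul_of_one_le_of_one_le hm1 hkr,
      fun s x₀ t hx hst => ?_, fun s x₀ t hx hts => ?_⟩
    · rw [mul_assoc m⁻¹]
      refine F.abs_sub_le hq hda hm0 ?_ ((hEa s t hst).trans ?_)
      · rcases le_total 0 (x₀ - a s) with hy | hy
        · exact (min_le_left _ _).trans (one_le_bernoulliDenom (.inl ⟨hst, hy⟩))
        · refine le_trans ?_ (le_bernoulliDenom hq hda hdr
            (fun t => (by linarith [hpos t] : r t - a t < 0).ne)
            (div_nonneg_of_nonpos hy (by linarith [hpos t])))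
          rw [← neg_div_neg_eq, neg_sub (r s)]
          exact hrel (by linarith)
      · gcongr
    · rw [mul_assoc m⁻¹]
      refine F.abs_sub_le hq hdr hm0 ?_ ((hEr s t hts).trans ?_)
      · rcases le_total (x₀ - r s) 0 with hy | hy
        · exact (min_le_left _ _).trans (one_le_bernoulliDenom (.inr ⟨hts, hy⟩))
        · exact (hrel (by linarith)).trans (le_bernoulliDenom hq hdr hda
            (fun t => (hpos t).ne') (div_nonneg hy (hpos t).le))
      · have : βr * (t - s) ≤ βr' * (t - s) :=
          mul_le_mul_of_nonpos_right hβr.le (sub_nonpos.2 hts)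
        gcongr
  · simpa using F.abs_sub_le hq hda one_pos
      (one_le_bernoulliDenom (.inl ⟨hst, sub_nonneg.2 hx⟩)) (hEa s t hst)
  · simpa using F.abs_sub_le hq hdr one_pos
      (one_le_bernoulliDenom (.inr ⟨hts, sub_nonpos.2 hx⟩)) (hEr s t hts)
end

section
/- Suppose the equation x' = −x² + q(t)x + p(t) has bounded solutions and the globally defined solutions a and r are uniformly separated. Then the equation has no hyperbolic solutions other than a and r, and a and r are the unique pair of globally defined bounded solutions of the equation which are uniformly separated. -/
open Set Filter

section QuadraticODE

variable {q p x y b a r : ℝ → ℝ}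

/-- Two global solutions that meet at one time coincide. -/
theorem MaxSolFamily.eq_of_eq_at {h : ℝ → ℝ → ℝ} (F : MaxSolFamily h)
    (hx : ∀ t, HasDerivAt x (h t (x t)) t) (hy : ∀ t, HasDerivAt y (h t (y t)) t)
    {s : ℝ} (hs : x s = y s) : x = y := by
  funext t
  rw [(F.maximal s (x s) x univ isOpen_univ ordConnected_univ (mem_univ _) rfl
      fun t _ => hx t).2 t (mem_univ _),
    (F.maximal s (x s) y univ isOpen_univ ordConnected_univ (mem_univ _) hs.symm
      fun t _ => hy t).2 t (mem_univ _)]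

theorem MaxSolFamily.lt_of_le_of_ne {h : ℝ → ℝ → ℝ} (F : MaxSolFamily h)
    (hx : ∀ t, HasDerivAt x (h t (x t)) t) (hy : ∀ t, HasDerivAt y (h t (y t)) t)
    (hle : ∀ t, x t ≤ y t) (hne : x ≠ y) (t : ℝ) : x t < y t :=
  (hle t).lt_of_ne fun ht => hne (F.eq_of_eq_at hx hy ht)

theorem CharA.le_of_isBddSol {F : MaxSolFamily (quadF q p)} (ha : CharA F a)
    (hb : IsBddSol q p b) (s : ℝ) : b s ≤ a s := by
  obtain ⟨hb, C, hC⟩ := hb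
  have hF := F.maximal s (b s) b univ isOpen_univ ordConnected_univ (mem_univ _) rfl
    fun t _ => hb t
  refine (ha.2.2 s (b s)).1 ⟨C, Eventually.of_forall fun t => ⟨hF.1 (mem_univ t), ?_⟩⟩
  rw [← hF.2 t (mem_univ t)]
  exact hC t

theorem CharR.le_of_isBddSol {F : MaxSolFamily (quadF q p)} (hr : CharR F r)
    (hb : IsBddSol q p b) (s : ℝ) : r s ≤ b s := by
  obtain ⟨hb, C, hC⟩ := hb
  have hF := F.maximal s (b s) b univ isOpen_univ ordConnected_univ (mem_univ _) rfl
    fun t _ => hb t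
  refine (hr.2.2 s (b s)).1 ⟨C, Eventually.of_forall fun t => ⟨hF.1 (mem_univ t), ?_⟩⟩
  rw [← hF.2 t (mem_univ t)]
  exact hC t

theorem hasDerivAt_log_sub_of_quadF (hx : ∀ t, HasDerivAt x (quadF q p t (x t)) t)
    (hy : ∀ t, HasDerivAt y (quadF q p t (y t)) t) (hlt : ∀ t, x t < y t) (t : ℝ) :
    HasDerivAt (fun t => Real.log (y t - x t)) (q t - x t - y t) t := by
  have hpos : y t - x t ≠ 0 := (sub_pos.2 (hlt t)).ne'
  convert ((hy t).fun_sub (hx t)).log hpos using 1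
  unfold quadF
  field_simp
  ring

/-- The logarithm of the ratio of the gaps `a - b` and `b - r` decreases at a definite rate. -/
theorem antitone_log_sub_sub_log_sub (ha : ∀ t, HasDerivAt a (quadF q p t (a t)) t)
    (hb : ∀ t, HasDerivAt b (quadF q p t (b t)) t)
    (hr : ∀ t, HasDerivAt r (quadF q p t (r t)) t)
    (hrb : ∀ t, r t < b t) (hba : ∀ t, b t < a t) {δ : ℝ} (hδ : ∀ t, δ ≤ a t - r t) :
    Antitone fun t => Real.log (a t - b t) - Real.log (b t - r t) + δ * t := by
  have hd (t : ℝ) := ((hasDerivAt_log_sub_of_quadF hb ha hba t).fun_sub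
    (hasDerivAt_log_sub_of_quadF hr hb hrb t)).fun_add ((hasDerivAt_id' t).const_mul δ)
  refine antitone_of_deriv_nonpos (fun t => (hd t).differentiableAt) fun t => ?_
  rw [(hd t).deriv]
  linarith [hδ t]

theorem tendsto_log_sub_atBot (ha : IsBddSol q p a) (hb : IsBddSol q p b)
    (hr : IsBddSol q p r) (hrb : ∀ t, r t < b t) (hba : ∀ t, b t < a t)
    (hsep : ∃ δ > (0 : ℝ), ∀ t, δ ≤ a t - r t) :
    Tendsto (fun t => Real.log (b t - r t)) atBot atBot := by
  obtain ⟨δ, hδ0, hδ⟩ := hsep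
  obtain ⟨A, hA⟩ := ha.2
  obtain ⟨B, hB⟩ := hb.2
  have hanti := antitone_log_sub_sub_log_sub ha.1 hb.1 hr.1 hrb hba hδ
  set c := Real.log (a 0 - b 0) - Real.log (b 0 - r 0)
  refine tendsto_atBot_mono' _ ?_
    (tendsto_atBot_add_const_left _ (Real.log (A + B) - c) (tendsto_id.const_mul_atBot hδ0))
  filter_upwards [eventually_le_atBot 0] with t ht
  have h1 := hanti ht
  have h2 := Real.log_le_log (sub_pos.2 (hba t))
    (show a t - b t ≤ A + B by linarith [(abs_le.1 (hA t)).2, (abs_le.1 (hB t)).1])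
  simp only [id] at h1 ⊢
  linarith

theorem tendsto_log_sub_atTop (ha : IsBddSol q p a) (hb : IsBddSol q p b)
    (hr : IsBddSol q p r) (hrb : ∀ t, r t < b t) (hba : ∀ t, b t < a t)
    (hsep : ∃ δ > (0 : ℝ), ∀ t, δ ≤ a t - r t) :
    Tendsto (fun t => Real.log (a t - b t)) atTop atBot := by
  obtain ⟨δ, hδ0, hδ⟩ := hsep
  obtain ⟨B, hB⟩ := hb.2
  obtain ⟨R, hR⟩ := hr.2
  have hanti := antitone_log_sub_sub_log_sub ha.1 hb.1 hr.1 hrb hba hδ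
  set c := Real.log (a 0 - b 0) - Real.log (b 0 - r 0)
  refine tendsto_atBot_mono' _ ?_ (tendsto_atBot_add_const_left _ (Real.log (B + R) + c)
    (tendsto_id.const_mul_atTop_of_neg (neg_neg_of_pos hδ0)))
  filter_upwards [eventually_ge_atTop 0] with t ht
  have h1 := hanti ht
  have h2 := Real.log_le_log (sub_pos.2 (hrb t))
    (show b t - r t ≤ B + R by linarith [(abs_le.1 (hB t)).2, (abs_le.1 (hR t)).1])
  simp only [id] at h1 ⊢
  linarith

theorem hasDerivAt_integral_variational (hq : Continuous q) (hb : Continuous b) (t : ℝ) :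
    HasDerivAt (fun t => ∫ l in (0 : ℝ)..t, (-2 * b l + q l)) (-2 * b t + q t) t :=
  ((continuous_const.mul hb).add hq).integral_hasStrictDerivAt 0 t |>.hasDerivAt

/-- No solution below an attractive hyperbolic one is asymptotic to it in the past. -/
theorem AttrDich.not_tendsto_log_sub (hq : Continuous q)
    (hb : ∀ t, HasDerivAt b (quadF q p t (b t)) t)
    (hr : ∀ t, HasDerivAt r (quadF q p t (r t)) t) (hrb : ∀ t, r t < b t) {k β : ℝ}
    (h : AttrDich q b k β) : ¬ Tendsto (fun t => Real.log (b t - r t)) atBot atBot := by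
  intro hlim
  obtain ⟨hk, hβ, hexp⟩ := h
  obtain ⟨T, hT⟩ := eventually_atBot.1 (hlim.eventually_le_atBot (Real.log β))
  have hd (t : ℝ) := ((hasDerivAt_log_sub_of_quadF hr hb hrb t).fun_sub
    (hasDerivAt_integral_variational hq
      (continuous_iff_continuousAt.2 fun t => (hb t).continuousAt) t)).fun_sub
    ((hasDerivAt_id' t).const_mul β)
  have hanti := antitoneOn_of_deriv_nonpos (convex_Iic T)
    (fun t _ => (hd t).continuousAt.continuousWithinAt)
    (fun t _ => (hd t).differentiableAt.differentiableWithinAt) fun t ht => by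
      rw [(hd t).deriv]
      have := (Real.log_le_log_iff (sub_pos.2 (hrb t)) hβ).1 (hT t (mem_Iic.1 (interior_subset ht)))
      linarith
  obtain ⟨s, hs, hsT, hs0⟩ := ((hlim.eventually_lt_atBot
    (Real.log (b T - r T) - (∫ l in (0 : ℝ)..T, (-2 * b l + q l)) - β * T - Real.log k)).and
      ((eventually_le_atBot T).and (eventually_le_atBot 0))).exists
  have h1 := hanti (mem_Iic.2 hsT) (mem_Iic.2 le_rfl) hsT
  have h2 := Real.log_le_log (Real.exp_pos _) (hexp s 0 hs0)
  rw [Real.log_exp, Real.log_mul (by positivity) (Real.exp_ne_zero _), Real.log_exp,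
    intervalIntegral.integral_symm] at h2
  linarith

/-- No solution above a repulsive hyperbolic one is asymptotic to it in the future. -/
theorem RepDich.not_tendsto_log_sub (hq : Continuous q)
    (ha : ∀ t, HasDerivAt a (quadF q p t (a t)) t)
    (hb : ∀ t, HasDerivAt b (quadF q p t (b t)) t) (hba : ∀ t, b t < a t) {k β : ℝ}
    (h : RepDich q b k β) : ¬ Tendsto (fun t => Real.log (a t - b t)) atTop atBot := by
  intro hlim
  obtain ⟨hk, hβ, hexp⟩ := h
  obtain ⟨T, hT⟩ := eventually_atTop.1 (hlim.eventually_le_atBot (Real.log β))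
  have hd (t : ℝ) := ((hasDerivAt_log_sub_of_quadF hb ha hba t).fun_sub
    (hasDerivAt_integral_variational hq
      (continuous_iff_continuousAt.2 fun t => (hb t).continuousAt) t)).fun_add
    ((hasDerivAt_id' t).const_mul β)
  have hmono := monotoneOn_of_deriv_nonneg (convex_Ici T)
    (fun t _ => (hd t).continuousAt.continuousWithinAt)
    (fun t _ => (hd t).differentiableAt.differentiableWithinAt) fun t ht => by
      rw [(hd t).deriv]
      have := (Real.log_le_log_iff (sub_pos.2 (hba t)) hβ).1 (hT t (mem_Ici.1 (interior_subset ht)))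
      linarith
  obtain ⟨s, hs, hsT, hs0⟩ := ((hlim.eventually_lt_atBot
    (Real.log (a T - b T) - (∫ l in (0 : ℝ)..T, (-2 * b l + q l)) + β * T - Real.log k)).and
      ((eventually_ge_atTop T).and (eventually_ge_atTop 0))).exists
  have h1 := hmono (mem_Ici.2 le_rfl) (mem_Ici.2 hsT) hsT
  have h2 := Real.log_le_log (Real.exp_pos _) (hexp s 0 hs0)
  rw [Real.log_exp, Real.log_mul (by positivity) (Real.exp_ne_zero _), Real.log_exp,
    intervalIntegral.integral_symm] at h2
  linarith

/-- The logarithm of a function bounded away from zero does not tend to `-∞`. -/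
theorem not_tendsto_log_of_le {l : Filter ℝ} [l.NeBot] {δ : ℝ} (hδ : 0 < δ)
    (h : ∀ t, δ ≤ x t) : ¬ Tendsto (fun t => Real.log (x t)) l atBot := fun hlim => by
  obtain ⟨t, ht⟩ := (hlim.eventually_lt_atBot (Real.log δ)).exists
  exact ht.not_ge (Real.log_le_log hδ (h t))

end QuadraticODE

theorem stmt10 (q p : ℝ → ℝ)
    (hqb : ∃ C, ∀ t, |q t| ≤ C) (hqu : UniformContinuous q)
    (hpb : ∃ C, ∀ t, |p t| ≤ C) (hpu : UniformContinuous p)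
    (F : MaxSolFamily (quadF q p))
    (a r : ℝ → ℝ)
    (ha : CharA F a) (hr : CharR F r)
    (hsep : ∃ δ > (0:ℝ), ∀ t, δ ≤ a t - r t) :
    -- no hyperbolic solutions other than a and r
    (∀ b : ℝ → ℝ, IsHyp q p b → b = a ∨ b = r) ∧
    -- a and r are the unique pair of globally defined bounded solutions
    -- which are uniformly separated
    (∀ b₁ b₂ : ℝ → ℝ, IsBddSol q p b₁ → IsBddSol q p b₂ →
      (∃ δ > (0:ℝ), ∀ t, δ ≤ b₂ t - b₁ t) → b₁ = r ∧ b₂ = a) := by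
  have haS : IsBddSol q p a := ⟨ha.1, ha.2.1⟩
  have hrS : IsBddSol q p r := ⟨hr.1, hr.2.1⟩
  have lt_a {b : ℝ → ℝ} (hb : IsBddSol q p b) (hne : b ≠ a) : ∀ t, b t < a t :=
    F.lt_of_le_of_ne hb.1 ha.1 (ha.le_of_isBddSol hb) hne
  have r_lt {b : ℝ → ℝ} (hb : IsBddSol q p b) (hne : b ≠ r) : ∀ t, r t < b t :=
    F.lt_of_le_of_ne hr.1 hb.1 (hr.le_of_isBddSol hb) hne.symm
  refine ⟨fun b hb => ?_, fun b₁ b₂ hb₁ hb₂ ⟨δ, hδ, hgap⟩ => ⟨?_, ?_⟩⟩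
  · by_contra! hne
    rcases hb with ⟨hb, k, β, hdich⟩ | ⟨hb, k, β, hdich⟩
    · exact hdich.not_tendsto_log_sub hqu.continuous hb.1 hr.1 (r_lt hb hne.2)
        (tendsto_log_sub_atBot haS hb hrS (r_lt hb hne.2) (lt_a hb hne.1) hsep)
    · exact hdich.not_tendsto_log_sub hqu.continuous ha.1 hb.1 (lt_a hb hne.1)
        (tendsto_log_sub_atTop haS hb hrS (r_lt hb hne.2) (lt_a hb hne.1) hsep)
  · by_contra hne
    have hle (t : ℝ) : δ ≤ a t - b₁ t := by linarith [hgap t, ha.le_of_isBddSol hb₂ t]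
    have hne' : b₁ ≠ a := fun h => by linarith [hle 0, congrFun h 0]
    exact not_tendsto_log_of_le hδ hle
      (tendsto_log_sub_atTop haS hb₁ hrS (r_lt hb₁ hne) (lt_a hb₁ hne') hsep)
  · by_contra hne
    have hle (t : ℝ) : δ ≤ b₂ t - r t := by linarith [hgap t, hr.le_of_isBddSol hb₁ t]
    have hne' : b₂ ≠ r := fun h => by linarith [hle 0, congrFun h 0]
    exact not_tendsto_log_of_le hδ hle
      (tendsto_log_sub_atBot haS hb₂ hrS (r_lt hb₂ hne') (lt_a hb₂ hne) hsep)
end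

section
/- There exists a unique real number λ* = λ*(q,p) belonging to the interval [−‖q²/4 + p‖, ‖p‖] such that the equation x' = −x² + q(t)x + p(t) + λ has a globally defined bounded solution if and only if λ ≥ λ*. -/
open Set Filter

open MeasureTheory Topology

/-- A bounded function with `D' + K D ≤ 0` on the whole line is nonpositive. -/
theorem nonpos_of_deriv_add_mul_nonpos {K C : ℝ} (hK : 0 < K) {D D' : ℝ → ℝ}
    (hD : ∀ t, HasDerivAt D (D' t) t) (hb : ∀ t, |D t| ≤ C)
    (h : ∀ t, D' t + K * D t ≤ 0) (t : ℝ) : D t ≤ 0 := by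
  have hder : ∀ s, HasDerivAt (fun s => Real.exp (K * s) * D s)
      (Real.exp (K * s) * (D' s + K * D s)) s := fun s => by
    have h1 : HasDerivAt (fun s => Real.exp (K * s)) (Real.exp (K * s) * K) s := by
      simpa using ((hasDerivAt_id s).const_mul K).exp
    exact (h1.mul (hD s)).congr_deriv (by ring)
  have hanti : Antitone fun s => Real.exp (K * s) * D s :=
    antitone_of_deriv_nonpos (fun s => (hder s).differentiableAt) fun s => by
      rw [(hder s).deriv]
      exact mul_nonpos_of_nonneg_of_nonpos (Real.exp_pos _).le (h s)
  have hexp : Tendsto (fun s => Real.exp (K * s)) atBot (𝓝 0) :=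
    Real.tendsto_exp_atBot.comp (tendsto_id.const_mul_atBot hK)
  have hlim : Tendsto (fun s => Real.exp (K * s) * D s) atBot (𝓝 0) := by
    refine squeeze_zero_norm (fun s => ?_) (by simpa using hexp.mul_const C)
    rw [Real.norm_eq_abs, abs_mul, abs_of_pos (Real.exp_pos _)]
    exact mul_le_mul_of_nonneg_left (hb s) (Real.exp_pos _).le
  have := hanti.ge_of_tendsto hlim t
  by_contra! hc
  exact absurd this (not_le.2 (mul_pos (Real.exp_pos _) hc))

/-- The bounded solution `t ↦ ∫ s in Iic t, exp (-K (t - s)) h s` of `y' = -K y + h`. -/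
noncomputable def expConv (K : ℝ) (h : ℝ → ℝ) (t : ℝ) : ℝ :=
  Real.exp (-(K * t)) * ∫ s in Iic t, Real.exp (K * s) * h s

theorem integrableOn_exp_mul_bounded {K B : ℝ} (hK : 0 < K) {h : ℝ → ℝ} (hm : Measurable h)
    (hB : ∀ t, |h t| ≤ B) (t : ℝ) : IntegrableOn (fun s => Real.exp (K * s) * h s) (Iic t) :=
  (integrableOn_exp_mul_Iic hK t).mul_bdd hm.aestronglyMeasurable (ae_of_all _ hB)

theorem abs_expConv_le {K B : ℝ} (hK : 0 < K) {h : ℝ → ℝ}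
    (hB : ∀ t, |h t| ≤ B) (t : ℝ) : |expConv K h t| ≤ B / K := by
  have h1 : ‖∫ s in Iic t, Real.exp (K * s) * h s‖ ≤ ∫ s in Iic t, Real.exp (K * s) * B := by
    refine norm_integral_le_of_norm_le ((integrableOn_exp_mul_Iic hK t).mul_const B)
      (ae_of_all _ fun s => ?_)
    rw [Real.norm_eq_abs, abs_mul, abs_of_pos (Real.exp_pos _)]
    exact mul_le_mul_of_nonneg_left (hB s) (Real.exp_pos _).le
  rw [integral_mul_const, integral_exp_mul_Iic hK, Real.norm_eq_abs] at h1
  rw [expConv, abs_mul, abs_of_pos (Real.exp_pos _)]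
  refine (mul_le_mul_of_nonneg_left h1 (Real.exp_pos _).le).trans (le_of_eq ?_)
  rw [Real.exp_neg]
  field_simp

theorem expConv_eq {K B : ℝ} (hK : 0 < K) {h : ℝ → ℝ} (hm : Measurable h)
    (hB : ∀ t, |h t| ≤ B) : expConv K h = fun t => Real.exp (-(K * t)) *
      ((∫ s in Iic 0, Real.exp (K * s) * h s) + ∫ s in (0 : ℝ)..t, Real.exp (K * s) * h s) := by
  funext t
  rw [expConv, ← intervalIntegral.integral_Iic_sub_Iic (integrableOn_exp_mul_bounded hK hm hB 0)
    (integrableOn_exp_mul_bounded hK hm hB t)]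
  ring

theorem continuous_expConv {K B : ℝ} (hK : 0 < K) {h : ℝ → ℝ} (hm : Measurable h)
    (hB : ∀ t, |h t| ≤ B) : Continuous (expConv K h) := by
  rw [expConv_eq hK hm hB]
  have hint : ∀ a b, IntervalIntegrable (fun s => Real.exp (K * s) * h s) volume a b := fun a b =>
    ⟨(integrableOn_exp_mul_bounded hK hm hB b).mono_set fun _ hx => hx.2,
      (integrableOn_exp_mul_bounded hK hm hB a).mono_set fun _ hx => hx.2⟩
  have := intervalIntegral.continuous_primitive hint 0
  fun_prop

theorem hasDerivAt_expConv {K B : ℝ} (hK : 0 < K) {h : ℝ → ℝ} (hc : Continuous h)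
    (hB : ∀ t, |h t| ≤ B) (t : ℝ) :
    HasDerivAt (expConv K h) (-K * expConv K h t + h t) t := by
  have hcont : Continuous fun s => Real.exp (K * s) * h s := by fun_prop
  have h1 : HasDerivAt (fun t => Real.exp (-(K * t))) (Real.exp (-(K * t)) * (-K)) t := by
    simpa using ((hasDerivAt_id t).const_mul K).neg.exp
  have h2 := (hcont.integral_hasStrictDerivAt 0 t).hasDerivAt.const_add
    (∫ s in Iic 0, Real.exp (K * s) * h s)
  rw [expConv_eq hK hc.measurable hB]
  refine (h1.mul h2).congr_deriv ?_
  rw [← mul_assoc (Real.exp (-(K * t))), ← Real.exp_add]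
  simp
  ring

theorem tendsto_expConv {K B : ℝ} (hK : 0 < K) {h : ℕ → ℝ → ℝ} {h₀ : ℝ → ℝ}
    (hm : ∀ n, Measurable (h n)) (hB : ∀ n t, |h n t| ≤ B)
    (hlim : ∀ t, Tendsto (fun n => h n t) atTop (𝓝 (h₀ t))) (t : ℝ) :
    Tendsto (fun n => expConv K (h n) t) atTop (𝓝 (expConv K h₀ t)) := by
  refine Tendsto.const_mul _ (tendsto_integral_of_dominated_convergence
    (fun s => Real.exp (K * s) * B) (fun n => ?_) ((integrableOn_exp_mul_Iic hK t).mul_const B)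
    (fun n => ae_of_all _ fun s => ?_) (ae_of_all _ fun s => (hlim s).const_mul _))
  · have := hm n
    exact Measurable.aestronglyMeasurable (by fun_prop)
  · rw [Real.norm_eq_abs, abs_mul, abs_of_pos (Real.exp_pos _)]
    exact mul_le_mul_of_nonneg_left (hB n s) (Real.exp_pos _).le

theorem quadF_add_mul_mono {Q : ℝ → ℝ} (P : ℝ → ℝ) {Cq M K t x y : ℝ} (hQ : |Q t| ≤ Cq)
    (hK : 2 * M + Cq ≤ K) (hx : |x| ≤ M) (hy : |y| ≤ M) (hxy : x ≤ y) :
    quadF Q P t x + K * x ≤ quadF Q P t y + K * y := by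
  rw [abs_le] at hQ hx hy
  have : 0 ≤ (y - x) * (K + Q t - (x + y)) :=
    mul_nonneg (by linarith) (by linarith)
  simp only [quadF]
  linarith

theorem abs_quadF_add_mul_le {Q P : ℝ → ℝ} {Cq Cp M K t x : ℝ} (hQ : |Q t| ≤ Cq)
    (hP : |P t| ≤ Cp) (hK : 0 < K) (hx : |x| ≤ M) :
    |quadF Q P t x + K * x| ≤ M ^ 2 + Cq * M + Cp + K * M := by
  have h1 : |-x ^ 2| ≤ M ^ 2 := by
    rw [abs_neg, abs_pow]
    exact pow_le_pow_left₀ (abs_nonneg _) hx 2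
  have h2 : |Q t * x| ≤ Cq * M := by
    rw [abs_mul]
    exact mul_le_mul hQ hx (abs_nonneg _) ((abs_nonneg _).trans hQ)
  have h3 : |K * x| ≤ K * M := by
    rw [abs_mul, abs_of_pos hK]
    exact mul_le_mul_of_nonneg_left hx hK.le
  simp only [quadF]
  exact (abs_add_le _ _).trans (add_le_add ((abs_add_le _ _).trans
    (add_le_add ((abs_add_le _ _).trans (add_le_add h1 h2)) hP)) h3)

/-- Pointwise limits of solutions, or of approximate solutions given by a fixed-point iteration,
are bounded solutions of the limit equation. -/
theorem isBddSol_of_tendsto {Q P₀ : ℝ → ℝ} {P : ℕ → ℝ → ℝ} {Cq Cp M K : ℝ} (hK : 0 < K)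
    (hQ : Continuous Q) (hQb : ∀ t, |Q t| ≤ Cq)
    (hP : ∀ n, Continuous (P n)) (hPb : ∀ n t, |P n t| ≤ Cp) (hP₀ : Continuous P₀)
    (hPlim : ∀ t, Tendsto (fun n => P n t) atTop (𝓝 (P₀ t)))
    {x y : ℕ → ℝ → ℝ} {x₀ : ℝ → ℝ} (hx : ∀ n, Continuous (x n)) (hxM : ∀ n t, |x n t| ≤ M)
    (hy : ∀ n, y n = expConv K fun s => quadF Q (P n) s (x n s) + K * x n s)
    (hxlim : ∀ t, Tendsto (fun n => x n t) atTop (𝓝 (x₀ t)))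
    (hylim : ∀ t, Tendsto (fun n => y n t) atTop (𝓝 (x₀ t))) : IsBddSol Q P₀ x₀ := by
  have hx₀M : ∀ t, |x₀ t| ≤ M := fun t =>
    le_of_tendsto (hxlim t).abs (Eventually.of_forall fun n => hxM n t)
  have hP₀b : ∀ t, |P₀ t| ≤ Cp := fun t =>
    le_of_tendsto (hPlim t).abs (Eventually.of_forall fun n => hPb n t)
  have hx₀m : Measurable x₀ :=
    measurable_of_tendsto_metrizable (fun n => (hx n).measurable) (tendsto_pi_nhds.2 hxlim)
  have hfix : x₀ = expConv K fun s => quadF Q P₀ s (x₀ s) + K * x₀ s := by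
    funext t
    refine tendsto_nhds_unique (hylim t) ?_
    simp only [hy]
    refine tendsto_expConv hK (fun n => ?_)
      (fun n t => abs_quadF_add_mul_le (hQb t) (hPb n t) hK (hxM n t)) (fun s => ?_) t
    · have h1 := hx n
      have h2 := hP n
      exact Continuous.measurable (by unfold quadF; fun_prop)
    · exact ((((hxlim s).pow 2).neg.add ((hxlim s).const_mul _)).add (hPlim s)).add
        ((hxlim s).const_mul K)
  have hbd : ∀ t, |quadF Q P₀ t (x₀ t) + K * x₀ t| ≤ M ^ 2 + Cq * M + Cp + K * M := fun t =>
    abs_quadF_add_mul_le (hQb t) (hP₀b t) hK (hx₀M t)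
  have hx₀ : Continuous x₀ := by
    rw [hfix]
    refine continuous_expConv hK ?_ hbd
    have h1 := hQ.measurable
    have h2 := hP₀.measurable
    unfold quadF
    fun_prop
  have hcont : Continuous fun s => quadF Q P₀ s (x₀ s) + K * x₀ s := by unfold quadF; fun_prop
  refine ⟨fun t => ?_, M, hx₀M⟩
  have := hasDerivAt_expConv hK hcont hbd t
  rw [← hfix] at this
  exact this.congr_deriv (by ring)

/-- `c` is a differentiable lower solution with `|c| ≤ M`. -/
def IsLowerSol (Q P : ℝ → ℝ) (M : ℝ) (c : ℝ → ℝ) : Prop :=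
  ∃ c' : ℝ → ℝ, (∀ t, HasDerivAt c (c' t) t) ∧ (∀ t, c' t ≤ quadF Q P t (c t)) ∧ ∀ t, |c t| ≤ M

theorem IsLowerSol.le_expConv {Q P c x : ℝ → ℝ} {Cq Cp M K : ℝ} (hK : 0 < K)
    (hKM : 2 * M + Cq ≤ K) (hQ : Continuous Q) (hQb : ∀ t, |Q t| ≤ Cq)
    (hP : Continuous P) (hPb : ∀ t, |P t| ≤ Cp) (hc : IsLowerSol Q P M c)
    (hx : Continuous x) (hxM : ∀ t, |x t| ≤ M) (hcx : ∀ t, c t ≤ x t) (t : ℝ) :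
    c t ≤ expConv K (fun s => quadF Q P s (x s) + K * x s) t := by
  obtain ⟨c', hd, hle, hcM⟩ := hc
  have hbd : ∀ t, |quadF Q P t (x t) + K * x t| ≤ M ^ 2 + Cq * M + Cp + K * M := fun t =>
    abs_quadF_add_mul_le (hQb t) (hPb t) hK (hxM t)
  have hcont : Continuous fun s => quadF Q P s (x s) + K * x s := by unfold quadF; fun_prop
  have := nonpos_of_deriv_add_mul_nonpos hK
    (fun t => (hd t).sub (hasDerivAt_expConv hK hcont hbd t))
    (fun t => (abs_sub _ _).trans (add_le_add (hcM t) (abs_expConv_le hK hbd t)))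
    (fun t => by
      have h1 := quadF_add_mul_mono P (hQb t) hKM (hcM t) (hxM t) (hcx t)
      have h2 := hle t
      simp only [Pi.sub_apply]
      linarith) t
  simpa using this

theorem expConv_mono {K B : ℝ} (hK : 0 < K) {h g : ℝ → ℝ} (hh : Continuous h) (hg : Continuous g)
    (hhB : ∀ t, |h t| ≤ B) (hgB : ∀ t, |g t| ≤ B) (hle : ∀ t, h t ≤ g t) (t : ℝ) :
    expConv K h t ≤ expConv K g t := by
  have := nonpos_of_deriv_add_mul_nonpos hK
    (fun t => (hasDerivAt_expConv hK hh hhB t).sub (hasDerivAt_expConv hK hg hgB t))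
    (fun t => (abs_sub _ _).trans (add_le_add (abs_expConv_le hK hhB t) (abs_expConv_le hK hgB t)))
    (fun t => by
      have := hle t
      simp only [Pi.sub_apply]
      linarith) t
  simpa using this

theorem expConv_le_const {K B M : ℝ} (hK : 0 < K) {h : ℝ → ℝ} (hh : Continuous h)
    (hhB : ∀ t, |h t| ≤ B) (hle : ∀ t, h t ≤ K * M) (t : ℝ) : expConv K h t ≤ M := by
  have := nonpos_of_deriv_add_mul_nonpos hK
    (fun t => (hasDerivAt_expConv hK hh hhB t).sub_const M)
    (fun t => (abs_sub _ M).trans (add_le_add_left (abs_expConv_le hK hhB t) _))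
    (fun t => by
      have := hle t
      linarith) t
  simpa using this

/-- Between a lower solution and the constant upper solution `M` there is a bounded solution,
maximal among the lower solutions. -/
theorem exists_maximal_bddSol {Q P c : ℝ → ℝ} {Cq Cp M : ℝ} (hM : 0 < M)
    (hQ : Continuous Q) (hQb : ∀ t, |Q t| ≤ Cq) (hP : Continuous P) (hPb : ∀ t, |P t| ≤ Cp)
    (hup : ∀ t, quadF Q P t M ≤ 0) (hc : IsLowerSol Q P M c) :
    ∃ x, IsBddSol Q P x ∧ (∀ t, |x t| ≤ M) ∧ ∀ c, IsLowerSol Q P M c → ∀ t, c t ≤ x t := by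
  obtain ⟨K, hK, hKM⟩ : ∃ K : ℝ, 0 < K ∧ 2 * M + Cq ≤ K :=
    ⟨2 * M + Cq, by linarith [(abs_nonneg _).trans (hQb 0)], le_rfl⟩
  let g : (ℝ → ℝ) → ℝ → ℝ := fun x s => quadF Q P s (x s) + K * x s
  let x : ℕ → ℝ → ℝ := fun n => Nat.rec (fun _ => M) (fun _ y => expConv K (g y)) n
  have hgc : ∀ y, Continuous y → Continuous (g y) := fun y hy => by
    simp only [g]; unfold quadF; fun_prop
  have hgb : ∀ y : ℝ → ℝ, (∀ t, |y t| ≤ M) → ∀ t, |g y t| ≤ M ^ 2 + Cq * M + Cp + K * M :=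
    fun y hy t => abs_quadF_add_mul_le (hQb t) (hPb t) hK (hy t)
  have hMM : |M| ≤ M := (abs_of_pos hM).le
  have key : ∀ n, Continuous (x n) ∧ (∀ t, |x n t| ≤ M) ∧
      ∀ c, IsLowerSol Q P M c → ∀ t, c t ≤ x n t := by
    intro n
    induction n with
    | zero => exact ⟨continuous_const, fun t => hMM,
        fun c ⟨_, _, _, h⟩ t => (le_abs_self _).trans (h t)⟩
    | succ n ih =>
      obtain ⟨ih1, ih2, ih3⟩ := ih
      have hlow : ∀ c, IsLowerSol Q P M c → ∀ t, c t ≤ x (n + 1) t := fun c hc t =>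
        hc.le_expConv hK hKM hQ hQb hP hPb ih1 ih2 (ih3 c hc) t
      refine ⟨continuous_expConv hK (hgc _ ih1).measurable (hgb _ ih2), fun t => ?_, hlow⟩
      rw [abs_le]
      constructor
      · obtain ⟨_, _, _, h⟩ := id hc
        exact (abs_le.1 (h t)).1.trans (hlow c hc t)
      · refine expConv_le_const hK (hgc _ ih1) (hgb _ ih2) (fun t => ?_) t
        have := quadF_add_mul_mono P (hQb t) hKM (ih2 t) hMM (abs_le.1 (ih2 t)).2
        have := hup t
        simp only [g]
        linarith
  have hanti : ∀ t, Antitone fun n => x n t := by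
    have : ∀ n t, x (n + 1) t ≤ x n t := by
      intro n
      induction n with
      | zero => exact fun t => (abs_le.1 ((key 1).2.1 t)).2
      | succ n ih =>
        exact expConv_mono hK (hgc _ (key (n + 1)).1) (hgc _ (key n).1)
          (hgb _ (key (n + 1)).2.1) (hgb _ (key n).2.1) fun t =>
            quadF_add_mul_mono P (hQb t) hKM ((key (n + 1)).2.1 t) ((key n).2.1 t) (ih t)
    exact fun t => antitone_nat_of_succ_le fun n => this n t
  have hlim : ∀ t, Tendsto (fun n => x n t) atTop (𝓝 (⨅ n, x n t)) := fun t =>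
    tendsto_atTop_ciInf (hanti t) ⟨-M, by rintro _ ⟨n, rfl⟩; exact (abs_le.1 ((key n).2.1 t)).1⟩
  refine ⟨fun t => ⨅ n, x n t, ?_, fun t => ?_, fun c hc t => ?_⟩
  · exact isBddSol_of_tendsto (P := fun _ => P) (x := x) (y := fun n => x (n + 1)) hK hQ hQb
      (fun _ => hP) (fun _ => hPb) hP (fun _ => tendsto_const_nhds) (fun n => (key n).1)
      (fun n => (key n).2.1) (fun _ => rfl) hlim fun t => (hlim t).comp (tendsto_add_atTop_nat 1)
  · exact le_of_tendsto (hlim t).abs (Eventually.of_forall fun n => (key n).2.1 t)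
  · exact ge_of_tendsto (hlim t) (Eventually.of_forall fun n => (key n).2.2 c hc t)

theorem IsBddSol.isLowerSol {Q P P' b : ℝ → ℝ} {M : ℝ} (hb : IsBddSol Q P b)
    (hP : ∀ t, P t ≤ P' t) (hM : ∀ t, |b t| ≤ M) : IsLowerSol Q P' M b :=
  ⟨_, hb.1, fun t => by have := hP t; simp only [quadF]; linarith, hM⟩

theorem quadF_le_neg_one {Q P : ℝ → ℝ} {Cq Cp s t : ℝ} (hQ : |Q t| ≤ Cq) (hP : |P t| ≤ Cp)
    (hs : Cq + Cp + 1 ≤ s) : quadF Q P t s ≤ -1 := by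
  have hq := abs_le.1 hQ
  have hp := abs_le.1 hP
  have hp0 := (abs_nonneg _).trans hP
  have hq0 := (abs_nonneg _).trans hQ
  have : (Cp + 1) * 1 ≤ (s - Q t) * s :=
    mul_le_mul (by linarith) (by linarith) (by norm_num) (by linarith)
  simp only [quadF]
  nlinarith

theorem IsBddSol.le_const {Q P b : ℝ → ℝ} {Cq Cp : ℝ} (hb : IsBddSol Q P b)
    (hQ : ∀ t, |Q t| ≤ Cq) (hP : ∀ t, |P t| ≤ Cp) (t : ℝ) : b t ≤ Cq + Cp + 1 := by
  by_contra! hlt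
  obtain ⟨hd, C, hC⟩ := hb
  have hbdd : BddAbove (range b) := ⟨C, by rintro _ ⟨t, rfl⟩; exact (le_abs_self _).trans (hC t)⟩
  have hle : ∀ t, b t ≤ ⨆ t, b t := le_ciSup hbdd
  have hsC : ⨆ t, b t ≤ C := ciSup_le fun t => (le_abs_self _).trans (hC t)
  generalize hs : ⨆ t, b t = s at hle hsC
  have hlts : Cq + Cp + 1 < s := hlt.trans_le (hle t)
  have hp0 := (abs_nonneg _).trans (hP 0)
  have hq0 := (abs_nonneg _).trans (hQ 0)
  have hK : 0 < 2 * C + Cq := by linarith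
  have hmain : ∀ t, b t ≤ s - 1 / (2 * C + Cq) := fun t => by
    have := nonpos_of_deriv_add_mul_nonpos hK
      (fun t => (hd t).sub_const (s - 1 / (2 * C + Cq)))
      (fun t => (abs_sub _ _).trans (add_le_add_left (hC t) _))
      (fun t => by
        have h1 := quadF_add_mul_mono P (hQ t) le_rfl (hC t)
          (abs_le.2 ⟨by linarith, hsC⟩) (hle t)
        have h2 := quadF_le_neg_one (hQ t) (hP t) hlts.le
        have h3 : (2 * C + Cq) * (1 / (2 * C + Cq)) = 1 := by field_simp
        simp only [mul_sub, h3]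
        linarith) t
    simpa using this
  have : s ≤ s - 1 / (2 * C + Cq) := hs.ge.trans (ciSup_le hmain)
  have : 0 < 1 / (2 * C + Cq) := by positivity
  linarith

theorem IsBddSol.reflect {Q P b : ℝ → ℝ} (hb : IsBddSol Q P b) :
    IsBddSol (fun t => -Q (-t)) (fun t => P (-t)) fun t => -b (-t) := by
  obtain ⟨hd, C, hC⟩ := hb
  refine ⟨fun t => ?_, C, fun t => by simpa using hC (-t)⟩
  have := ((hd (-t)).scomp t (hasDerivAt_neg t)).neg
  refine this.congr_deriv ?_
  simp [quadF]

theorem IsBddSol.abs_le_const {Q P b : ℝ → ℝ} {Cq Cp : ℝ} (hb : IsBddSol Q P b)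
    (hQ : ∀ t, |Q t| ≤ Cq) (hP : ∀ t, |P t| ≤ Cp) (t : ℝ) : |b t| ≤ Cq + Cp + 1 := by
  have := hb.reflect.le_const (fun t => by simpa using hQ (-t)) (fun t => hP (-t)) (-t)
  rw [neg_neg] at this
  exact abs_le.2 ⟨by linarith, hb.le_const hQ hP t⟩

/-- A bounded solution represents itself through the integral operator. -/
theorem IsBddSol.eq_expConv {Q P b : ℝ → ℝ} {Cq Cp M K : ℝ} (hK : 0 < K) (hQ : Continuous Q)
    (hQb : ∀ t, |Q t| ≤ Cq) (hP : Continuous P) (hPb : ∀ t, |P t| ≤ Cp) (hb : IsBddSol Q P b)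
    (hM : ∀ t, |b t| ≤ M) : b = expConv K fun s => quadF Q P s (b s) + K * b s := by
  have hbc : Continuous b := continuous_iff_continuousAt.2 fun t => (hb.1 t).continuousAt
  have hcont : Continuous fun s => quadF Q P s (b s) + K * b s := by unfold quadF; fun_prop
  have hbd : ∀ t, |quadF Q P t (b t) + K * b t| ≤ M ^ 2 + Cq * M + Cp + K * M := fun t =>
    abs_quadF_add_mul_le (hQb t) (hPb t) hK (hM t)
  have hder := hasDerivAt_expConv hK hcont hbd
  funext t
  refine le_antisymm (sub_nonpos.1 ?_) (sub_nonpos.1 ?_)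
  · exact nonpos_of_deriv_add_mul_nonpos hK (fun t => (hb.1 t).sub (hder t))
      (fun t => (abs_sub _ _).trans (add_le_add (hM t) (abs_expConv_le hK hbd t)))
      (fun t => by simp only [Pi.sub_apply]; linarith) t
  · exact nonpos_of_deriv_add_mul_nonpos hK (fun t => (hder t).sub (hb.1 t))
      (fun t => (abs_sub _ _).trans (add_le_add (abs_expConv_le hK hbd t) (hM t)))
      (fun t => by simp only [Pi.sub_apply]; linarith) t

theorem exists_isBddSol_mono {Q P P' : ℝ → ℝ} {Cq Cp : ℝ} (hQ : Continuous Q)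
    (hQb : ∀ t, |Q t| ≤ Cq) (hP' : Continuous P') (hPb : ∀ t, |P t| ≤ Cp)
    (hPb' : ∀ t, |P' t| ≤ Cp) (hle : ∀ t, P t ≤ P' t) (h : ∃ b, IsBddSol Q P b) :
    ∃ x, IsBddSol Q P' x ∧ (∀ t, |x t| ≤ Cq + Cp + 1) ∧
      ∀ c, IsLowerSol Q P' (Cq + Cp + 1) c → ∀ t, c t ≤ x t := by
  obtain ⟨b, hb⟩ := h
  have hp0 := (abs_nonneg _).trans (hPb 0)
  have hq0 := (abs_nonneg _).trans (hQb 0)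
  exact exists_maximal_bddSol (by linarith) hQ hQb hP' hPb'
    (fun t => (quadF_le_neg_one (hQb t) (hPb' t) le_rfl).trans (by norm_num))
    (hb.isLowerSol hle (hb.abs_le_const hQb hPb))

theorem neg_iSup_le_of_isBddSol {q p b : ℝ → ℝ} {l : ℝ}
    (hbdd : BddAbove (range fun t => |q t ^ 2 / 4 + p t|))
    (hb : IsBddSol q (fun t => p t + l) b) : -(⨆ t, |q t ^ 2 / 4 + p t|) ≤ l := by
  by_contra! hlt
  obtain ⟨hd, C, hC⟩ := hb
  generalize hN : ⨆ t, |q t ^ 2 / 4 + p t| = N at hlt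
  have hle : ∀ t, q t ^ 2 / 4 + p t ≤ N := fun t =>
    hN ▸ (le_abs_self _).trans (le_ciSup hbdd t)
  have hε : 0 < -(N + l) := by linarith
  obtain ⟨n, hn⟩ := exists_nat_gt (2 * C / -(N + l))
  rw [div_lt_iff₀ hε] at hn
  have := image_sub_le_mul_sub_of_deriv_le (f := b) (C := N + l)
    (fun t => (hd t).differentiableAt) (fun t => by
      rw [(hd t).deriv]
      simp only [quadF]
      nlinarith [hle t, sq_nonneg (b t - q t / 2)]) (Nat.cast_nonneg n)
  have h0 := abs_le.1 (hC 0)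
  have h1 := abs_le.1 (hC n)
  nlinarith

theorem stmt11 (q p : ℝ → ℝ)
    (hqb : ∃ C, ∀ t, |q t| ≤ C) (hqu : UniformContinuous q)
    (hpb : ∃ C, ∀ t, |p t| ≤ C) (hpu : UniformContinuous p) :
    ∃! lam : ℝ,
      lam ∈ Set.Icc (-(⨆ t : ℝ, |q t ^ 2 / 4 + p t|)) (⨆ t : ℝ, |p t|) ∧
      ∀ lamb : ℝ, (∃ b : ℝ → ℝ, IsBddSol q (fun t => p t + lamb) b) ↔ lam ≤ lamb := by
  obtain ⟨Cq, hCq⟩ := hqb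
  obtain ⟨Cp, hCp⟩ := hpb
  have hq := hqu.continuous
  have hp := hpu.continuous
  have hp0 := (abs_nonneg _).trans (hCp 0)
  have hbddp : BddAbove (range fun t => |p t|) := ⟨Cp, by rintro _ ⟨t, rfl⟩; exact hCp t⟩
  have hbdd : BddAbove (range fun t => |q t ^ 2 / 4 + p t|) := by
    refine ⟨Cq ^ 2 / 4 + Cp, ?_⟩
    rintro _ ⟨t, rfl⟩
    refine (abs_add_le _ _).trans (add_le_add ?_ (hCp t))
    rw [abs_of_nonneg (by positivity), ← sq_abs]
    gcongr
    exact hCq t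
  have hPb : ∀ {l Λ : ℝ}, |l| ≤ Λ → ∀ t, |p t + l| ≤ Cp + Λ := fun hl t =>
    (abs_add_le _ _).trans (add_le_add (hCp t) hl)
  let S : Set ℝ := {l | ∃ b, IsBddSol q (fun t => p t + l) b}
  have hmono : ∀ {l m Λ : ℝ}, |l| ≤ Λ → |m| ≤ Λ → l ≤ m → l ∈ S →
      ∃ x, IsBddSol q (fun t => p t + m) x ∧ (∀ t, |x t| ≤ Cq + (Cp + Λ) + 1) ∧
        ∀ c, IsLowerSol q (fun t => p t + m) (Cq + (Cp + Λ) + 1) c → ∀ t, c t ≤ x t :=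
    fun hl hm hlm h => exists_isBddSol_mono hq hCq (by fun_prop) (hPb hl) (hPb hm)
      (fun t => by linarith) h
  have hup : ∀ {l m : ℝ}, l ≤ m → l ∈ S → m ∈ S := fun {l m} hlm h => by
    obtain ⟨x, hx, _⟩ := hmono (le_max_left |l| |m|) (le_max_right _ _) hlm h
    exact ⟨x, hx⟩
  have htop : (⨆ t, |p t|) ∈ S := by
    set N := ⨆ t, |p t|
    have hpN : ∀ t, 0 ≤ p t + N := fun t => by
      have := le_ciSup hbddp t
      have := neg_abs_le (p t)
      linarith
    have hq0 := (abs_nonneg _).trans (hCq 0)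
    have hb := hPb (le_refl |N|)
    have hb0 := (abs_nonneg _).trans (hb 0)
    obtain ⟨x, hx, _⟩ := exists_maximal_bddSol (Q := q) (P := fun t => p t + N)
      (c := fun _ => 0) (M := Cq + (Cp + |N|) + 1) (by linarith) hq hCq (by fun_prop) hb
      (fun t => (quadF_le_neg_one (hCq t) (hb t) le_rfl).trans (by norm_num))
      ⟨fun _ => 0, fun t => hasDerivAt_const t 0, fun t => by simpa [quadF] using hpN t,
        fun t => by simp only [abs_zero]; linarith⟩
    exact ⟨x, hx⟩
  have hlow : ∀ l ∈ S, -(⨆ t, |q t ^ 2 / 4 + p t|) ≤ l := fun l ⟨_, hb⟩ =>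
    neg_iSup_le_of_isBddSol hbdd hb
  have hSb : BddBelow S := ⟨_, hlow⟩
  have hmin : sInf S ∈ S := by
    set L := sInf S
    let l : ℕ → ℝ := fun n => L + 1 / ((n : ℝ) + 1)
    have hlS : ∀ n, l n ∈ S := fun n => by
      obtain ⟨m, hm, hlt⟩ := exists_lt_of_csInf_lt ⟨_, htop⟩
        (show sInf S < l n from lt_add_of_pos_right _ Nat.one_div_pos_of_nat)
      exact hup hlt.le hm
    have hlb : ∀ n, |l n| ≤ |L| + 1 := fun n => by
      refine (abs_add_le _ _).trans (add_le_add le_rfl ?_)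
      rw [abs_of_pos Nat.one_div_pos_of_nat]
      exact (Nat.one_div_le_one_div (Nat.zero_le n)).trans (by simp)
    have hlanti : ∀ n, l (n + 1) ≤ l n := fun n =>
      add_le_add le_rfl (Nat.one_div_le_one_div n.le_succ)
    have hllim : Tendsto l atTop (𝓝 L) := by
      simpa [l] using tendsto_one_div_add_atTop_nhds_zero_nat.const_add L
    choose x hx hxM hmax using fun n => hmono (hlb n) (hlb n) le_rfl (hlS n)
    have hanti : ∀ t, Antitone fun n => x n t := fun t => antitone_nat_of_succ_le fun n =>
      hmax n _ ((hx (n + 1)).isLowerSol (fun t => by linarith [hlanti n]) (hxM (n + 1))) t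
    have hlim : ∀ t, Tendsto (fun n => x n t) atTop (𝓝 (⨅ n, x n t)) := fun t =>
      tendsto_atTop_ciInf (hanti t) ⟨_, by rintro _ ⟨n, rfl⟩; exact (abs_le.1 (hxM n t)).1⟩
    refine ⟨fun t => ⨅ n, x n t, isBddSol_of_tendsto (P := fun n t => p t + l n) one_pos hq hCq
      (fun n => by fun_prop) (fun n => hPb (hlb n)) (by fun_prop)
      (fun t => hllim.const_add (p t))
      (fun n => continuous_iff_continuousAt.2 fun t => ((hx n).1 t).continuousAt) hxM
      (fun n => (hx n).eq_expConv one_pos hq hCq (by fun_prop) (hPb (hlb n)) (hxM n)) hlim hlim⟩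
  refine ⟨sInf S, ⟨⟨hlow _ hmin, csInf_le hSb htop⟩, fun m =>
    ⟨fun h => csInf_le hSb h, fun h => hup h hmin⟩⟩, ?_⟩
  rintro l ⟨-, hl⟩
  exact le_antisymm ((hl _).1 hmin) (csInf_le hSb ((hl l).2 le_rfl))
end
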